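/- Let d ≥ 4 and set n = d − 1 (so the projected curve X lies in ℙⁿ with n ≥ 3). Let O = a·x^d + b·x^{d−1}y with a, b ∈ K and b ≠ 0 (so [O] lies on the tangent line to the rational normal curve at the point [x^d], and [O] ≠ [x^d]; the projected curve X has a cusp at the point Q = [x^d mod O]). Let F ∈ span_K{x^d, x^{d−1}y, x^{d−2}y²} with F ∉ span_K{x^d, x^{d−1}y}. Then R_X(F) = n = d − 1. (In other words, every point of E_Q(2) \ {Q}, where E_Q(2) is the image under the projection from [O] of the span of the length-3 osculating scheme of the rational normal curve at [x^d], has X-rank n.) -/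

import Mathlib

open MvPolynomial Submodule

noncomputable section

/-- A linear form: a nonzero binary (i.e. two-variable) form of degree `1`. -/
def IsLinForm {K : Type*} [CommSemiring K] (l : MvPolynomial (Fin 2) K) : Prop :=
  l ≠ 0 ∧ l.IsHomogeneous 1

/-- The `X`-rank of `F` with respect to the projection, from the point `[O]`, of the rational
normal curve `{[ℓ^d] : ℓ a linear form}`: the least `r` such that there are linear forms
`ℓ₁, …, ℓ_r` with `F ∈ span {ℓ₁^d, …, ℓ_r^d} + K·O`. -/
def RX {K : Type*} [Field K] (d : ℕ) (O F : MvPolynomial (Fin 2) K) : ℕ :=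
  sInf {r : ℕ | ∃ l : Fin r → MvPolynomial (Fin 2) K, (∀ i, IsLinForm (l i)) ∧
    F ∈ span K (insert O (Set.range fun i => l i ^ d))}

theorem IsLinForm.exists_eq {K : Type*} [CommSemiring K] {l : MvPolynomial (Fin 2) K}
    (hl : IsLinForm l) : ∃ u v : K, l = u • X 0 + v • X 1 := by
  have h : l ∈ homogeneousSubmodule (Fin 2) K 1 := hl.2
  have hr : Set.range (X : Fin 2 → MvPolynomial (Fin 2) K) = {X 0, X 1} := by
    ext p
    simp [Fin.exists_fin_two, eq_comm]
  rw [homogeneousSubmodule_one_eq_span_X, hr, mem_span_pair] at h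
  obtain ⟨u, v, h⟩ := h
  exact ⟨u, v, h.symm⟩

theorem isLinForm_smul_X_add_X {K : Type*} [Field K] (t : K) :
    IsLinForm (t • X 0 + X 1 : MvPolynomial (Fin 2) K) := by
  refine ⟨fun h => ?_, ?_⟩
  · have := congrArg (eval ![0, 1]) h
    simp [smul_eval] at this
  · rw [smul_eq_C_mul]
    exact ((isHomogeneous_X K 0).C_mul t).add (isHomogeneous_X K 1)

theorem coeff_single_add_single_X_pow_mul_X_pow {K : Type*} [CommSemiring K] (i j k l : ℕ) :
    coeff (Finsupp.single 0 k + Finsupp.single 1 l)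
      (X 0 ^ i * X 1 ^ j : MvPolynomial (Fin 2) K) = if i = k ∧ j = l then 1 else 0 := by
  classical
  rw [X_pow_eq_monomial, X_pow_eq_monomial, monomial_mul, coeff_monomial, one_mul]
  refine if_congr ?_ rfl rfl
  constructor
  · intro h
    exact ⟨by simpa using DFunLike.congr_fun h 0, by simpa using DFunLike.congr_fun h 1⟩
  · rintro ⟨rfl, rfl⟩
    rfl

theorem smul_X_add_smul_X_pow {K : Type*} [CommSemiring K] (u v : K) (d : ℕ) :
    (u • X 0 + v • X 1 : MvPolynomial (Fin 2) K) ^ d =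
      ∑ k ∈ Finset.range (d + 1),
        (d.choose k * u ^ k * v ^ (d - k) : K) • (X 0 ^ k * X 1 ^ (d - k)) := by
  rw [add_pow]
  refine Finset.sum_congr rfl fun k _ => ?_
  simp only [smul_eq_C_mul, map_mul, map_pow, map_natCast]
  ring

/-- The functional on binary forms of degree `d` pairing `x^k y^(d-k)` with
`q_k / (d choose k)` (apolarity), where `q` has degree at most `N`. -/
def apolar {K : Type*} [Field K] (d N : ℕ) (q : Polynomial K) : MvPolynomial (Fin 2) K →ₗ[K] K :=
  ∑ k ∈ Finset.range (N + 1),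
    (q.coeff k / d.choose k) • lcoeff K (Finsupp.single 0 k + Finsupp.single 1 (d - k))

theorem apolar_X_pow_mul_X_pow {K : Type*} [Field K] {d N : ℕ} (q : Polynomial K)
    {i : ℕ} (hi : i ≤ d) : apolar d N q (X 0 ^ i * X 1 ^ (d - i)) =
      if i ≤ N then q.coeff i / d.choose i else 0 := by
  have h (k : ℕ) : (i = k ∧ d - i = d - k) ↔ i = k := by grind
  simp only [apolar, LinearMap.sum_apply, LinearMap.smul_apply, lcoeff, LinearMap.coe_mk,
    AddHom.coe_mk, coeff_single_add_single_X_pow_mul_X_pow, h, smul_eq_mul, mul_ite, mul_one,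
    mul_zero, Finset.sum_ite_eq, Finset.mem_range, Nat.lt_succ_iff]

theorem apolar_pow_eq_zero {K : Type*} [Field K] [CharZero K] {d N : ℕ} (hN : N < d)
    {q : Polynomial K} (hq : q.natDegree ≤ N) {u v : K} (h : q.eval (u / v) = 0) :
    apolar d N q ((u • X 0 + v • X 1) ^ d) = 0 := by
  have hd : apolar d N q ((u • X 0 + v • X 1) ^ d) =
      ∑ k ∈ Finset.range (N + 1), q.coeff k * u ^ k * v ^ (d - k) := by
    rw [smul_X_add_smul_X_pow, map_sum,
      ← Finset.sum_subset (Finset.range_mono (by omega : N + 1 ≤ d + 1))]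
    · refine Finset.sum_congr rfl fun k hk => ?_
      have hk' : k ≤ N := by simpa [Nat.lt_succ_iff] using hk
      have hc : (d.choose k : K) ≠ 0 :=
        Nat.cast_ne_zero.2 (Nat.choose_pos (by omega)).ne'
      rw [map_smul, apolar_X_pow_mul_X_pow q (by omega), if_pos hk', smul_eq_mul]
      field_simp
    · intro k hk hk'
      simp only [Finset.mem_range] at hk hk'
      rw [map_smul, apolar_X_pow_mul_X_pow q (by omega), if_neg (by omega), smul_zero]
  rw [hd]
  by_cases hv : v = 0
  · refine Finset.sum_eq_zero fun k hk => ?_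
    simp only [Finset.mem_range] at hk
    rw [hv, zero_pow (by omega), mul_zero]
  · rw [Polynomial.eval_eq_sum_range' (Nat.lt_succ_of_le hq)] at h
    rw [← mul_zero (v ^ d), ← h, Finset.mul_sum]
    refine Finset.sum_congr rfl fun k hk => ?_
    simp only [Finset.mem_range] at hk
    have : v ^ d = v ^ (d - k) * v ^ k := by rw [← pow_add]; congr 1; omega
    rw [this, div_pow]
    field_simp

theorem notMem_span_of_card_add_two_le {K : Type*} [Field K] [CharZero K] {d r : ℕ}
    (hr : r + 2 ≤ d) (a b c₀ c₁ c₂ : K) (hc : c₂ ≠ 0)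
    (l : Fin r → MvPolynomial (Fin 2) K) (hl : ∀ i, IsLinForm (l i)) :
    c₀ • (X 0 : MvPolynomial (Fin 2) K) ^ d + c₁ • (X 0 ^ (d - 1) * X 1) +
        c₂ • (X 0 ^ (d - 2) * X 1 ^ 2) ∉
      span K (insert (a • (X 0 : MvPolynomial (Fin 2) K) ^ d + b • (X 0 ^ (d - 1) * X 1))
        (Set.range fun i => l i ^ d)) := by
  intro hF
  choose u v huv using fun i => (hl i).exists_eq
  set q : Polynomial K := Polynomial.X ^ (d - 2 - r) *
    ∏ i, (Polynomial.X - Polynomial.C (u i / v i)) with hq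
  have hmonic : q.Monic :=
    (Polynomial.monic_X_pow _).mul (Polynomial.monic_prod_of_monic _ _
      fun i _ => Polynomial.monic_X_sub_C _)
  have hdeg : q.natDegree = d - 2 := by
    rw [hq, (Polynomial.monic_X_pow _).natDegree_mul (Polynomial.monic_prod_of_monic _ _
      fun i _ => Polynomial.monic_X_sub_C _), Polynomial.natDegree_X_pow,
      Polynomial.natDegree_finsetProd_X_sub_C_eq_card]
    simp
    omega
  have h0 : apolar d (d - 2) q (X 0 ^ d) = 0 := by
    have := apolar_X_pow_mul_X_pow (N := d - 2) q (le_refl d)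
    rwa [Nat.sub_self, pow_zero, mul_one, if_neg (by omega)] at this
  have h1 : apolar d (d - 2) q (X 0 ^ (d - 1) * X 1) = 0 := by
    have := apolar_X_pow_mul_X_pow (N := d - 2) q (Nat.sub_le d 1)
    rwa [show d - (d - 1) = 1 by omega, pow_one, if_neg (by omega)] at this
  have h2 : apolar d (d - 2) q (X 0 ^ (d - 2) * X 1 ^ 2) = 1 / d.choose (d - 2) := by
    have := apolar_X_pow_mul_X_pow (N := d - 2) q (Nat.sub_le d 2)
    rwa [show d - (d - 2) = 2 by omega, if_pos le_rfl, ← hdeg, hmonic.coeff_natDegree,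
      hdeg] at this
  have hle : span K (insert (a • (X 0 : MvPolynomial (Fin 2) K) ^ d + b • (X 0 ^ (d - 1) * X 1))
      (Set.range fun i => l i ^ d)) ≤ LinearMap.ker (apolar d (d - 2) q) := by
    rw [span_le, Set.insert_subset_iff, Set.range_subset_iff]
    refine ⟨by simp [h0, h1], fun i => ?_⟩
    rw [SetLike.mem_coe, LinearMap.mem_ker, huv i]
    refine apolar_pow_eq_zero (by omega) hdeg.le ?_
    rw [hq, Polynomial.eval_mul, Polynomial.eval_prod,
      Finset.prod_eq_zero (Finset.mem_univ i) (by simp), mul_zero]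
  have hz := hle hF
  have hch : (d.choose (d - 2) : K) ≠ 0 :=
    Nat.cast_ne_zero.2 (Nat.choose_pos (by omega)).ne'
  simp [h0, h1, h2, hc, hch] at hz

theorem exists_separable_add_C {K : Type*} [Field K] [Infinite K]
    {p : Polynomial K} (hp : Polynomial.derivative p ≠ 0) :
    ∃ c : K, ∀ x, (p + Polynomial.C c).IsRoot x → ¬ (Polynomial.derivative p).IsRoot x := by
  classical
  obtain ⟨c, hc⟩ := Infinite.exists_notMem_finset
    ((Polynomial.derivative p).roots.toFinset.image fun x => -p.eval x)
  refine ⟨c, fun x hx hx' => hc (Finset.mem_image.2 ⟨x, ?_, ?_⟩)⟩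
  · simpa [hp] using hx'
  · rw [Polynomial.IsRoot.def, Polynomial.eval_add, Polynomial.eval_C] at hx
    exact (eq_neg_of_add_eq_zero_right hx).symm

theorem exists_injective_roots {K : Type*} [Field K] [IsAlgClosed K] [CharZero K] (n : ℕ) (e : K) :
    ∃ (c : K) (t : Fin (n + 3) → K), Function.Injective t ∧
      ∀ i, t i ^ (n + 3) + e * t i ^ (n + 1) + c = 0 := by
  classical
  set p : Polynomial K := Polynomial.X ^ (n + 3) + Polynomial.C e * Polynomial.X ^ (n + 1) with hp
  have hpd : p.natDegree = n + 3 := by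
    rw [hp]; compute_degree!
  have hp' : Polynomial.derivative p ≠ 0 := by
    intro h
    have := Polynomial.derivative_eq_zero.1 h
    omega
  obtain ⟨c, hc⟩ := exists_separable_add_C hp'
  have hd : (p + Polynomial.C c).natDegree = n + 3 := by
    rw [Polynomial.natDegree_add_C, hpd]
  have h0 : p + Polynomial.C c ≠ 0 := by
    intro h
    rw [h, Polynomial.natDegree_zero] at hd
    omega
  have hnodup : (p + Polynomial.C c).roots.Nodup := by
    rw [Multiset.nodup_iff_count_le_one]
    intro x
    rw [Polynomial.count_roots]
    by_contra! h
    have := (Polynomial.one_lt_rootMultiplicity_iff_isRoot h0).1 h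
    exact hc x this.1 (by simpa using this.2)
  have hcard : (p + Polynomial.C c).roots.toFinset.card = n + 3 := by
    rw [Multiset.toFinset_card_of_nodup hnodup,
      ← (IsAlgClosed.splits (p + Polynomial.C c)).natDegree_eq_card_roots, hd]
  let s := (Finset.equivFinOfCardEq hcard).symm
  refine ⟨c, fun i => s i, Subtype.val_injective.comp s.injective, fun i => ?_⟩
  have := (s i).2
  rw [Multiset.mem_toFinset, Polynomial.mem_roots h0] at this
  simpa [hp] using this

theorem exists_sum_mul_pow_eq {K : Type*} [Field K] {m : ℕ} {t : Fin m → K}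
    (ht : Function.Injective t) (M : Fin m → K) :
    ∃ w : Fin m → K, ∀ k : Fin m, ∑ i, w i * t i ^ (k : ℕ) = M k := by
  have hu : IsUnit (Matrix.vandermonde t) := by
    rw [Matrix.isUnit_iff_isUnit_det, isUnit_iff_ne_zero]
    exact Matrix.det_vandermonde_ne_zero_iff.2 ht
  obtain ⟨w, hw⟩ := (Matrix.vecMul_surjective_iff_isUnit.2 hu) M
  refine ⟨w, fun k => ?_⟩
  rw [← hw]
  rfl

theorem exists_isLinForm_mem_span {K : Type*} [Field K] [IsAlgClosed K] [CharZero K] (n : ℕ)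
    (α γ : K) (hγ : γ ≠ 0) :
    ∃ l : Fin (n + 3) → MvPolynomial (Fin 2) K, (∀ i, IsLinForm (l i)) ∧
      α • (X 0 : MvPolynomial (Fin 2) K) ^ (n + 4) + γ • (X 0 ^ (n + 2) * X 1 ^ 2) ∈
        span K (Set.range fun i => l i ^ (n + 4)) := by
  have hch : ((n + 4).choose (n + 2) : K) ≠ 0 :=
    Nat.cast_ne_zero.2 (Nat.choose_pos (by omega)).ne'
  set γ' : K := γ / (n + 4).choose (n + 2) with hγ'
  have hγ0 : γ' ≠ 0 := div_ne_zero hγ hch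
  obtain ⟨c, t, ht, hroot⟩ := exists_injective_roots n (-α / γ')
  obtain ⟨w, hw⟩ := exists_sum_mul_pow_eq ht (fun k => if (k : ℕ) = n + 2 then γ' else 0)
  have hlow (k : ℕ) (hk : k < n + 2) : ∑ i, w i * t i ^ k = 0 := by
    have := hw ⟨k, by omega⟩
    rwa [if_neg (by simp only; omega)] at this
  have hmid : ∑ i, w i * t i ^ (n + 2) = γ' := by
    simpa using hw ⟨n + 2, by omega⟩
  have hrec (j : ℕ) : ∑ i, w i * t i ^ (n + 3 + j) =
      α / γ' * ∑ i, w i * t i ^ (n + 1 + j) - c * ∑ i, w i * t i ^ j := by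
    rw [Finset.mul_sum, Finset.mul_sum, ← Finset.sum_sub_distrib]
    refine Finset.sum_congr rfl fun i _ => ?_
    linear_combination w i * t i ^ j * hroot i
  have h3 : ∑ i, w i * t i ^ (n + 3) = 0 := by
    have := hrec 0
    rwa [add_zero, add_zero, hlow (n + 1) (by omega), hlow 0 (by omega), mul_zero, mul_zero,
      sub_zero] at this
  have h4 : ∑ i, w i * t i ^ (n + 4) = α := by
    have := hrec 1
    rwa [hlow 1 (by omega), hmid, mul_zero, sub_zero, div_mul_cancel₀ _ hγ0] at this
  refine ⟨fun i => t i • X 0 + X 1, fun i => isLinForm_smul_X_add_X _, ?_⟩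
  have hsum : α • (X 0 : MvPolynomial (Fin 2) K) ^ (n + 4) + γ • (X 0 ^ (n + 2) * X 1 ^ 2) =
      ∑ i, w i • (t i • X 0 + X 1) ^ (n + 4) := by
    have hexp (i : Fin (n + 3)) : w i • (t i • X 0 + X 1 : MvPolynomial (Fin 2) K) ^ (n + 4) =
        ∑ k ∈ Finset.range (n + 5), ((n + 4).choose k * (w i * t i ^ k)) •
          (X 0 ^ k * X 1 ^ (n + 4 - k)) := by
      have := smul_X_add_smul_X_pow (t i) 1 (n + 4)
      rw [one_smul] at this
      rw [this, Finset.smul_sum]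
      refine Finset.sum_congr rfl fun k _ => ?_
      rw [smul_smul, one_pow]
      congr 1
      ring
    simp_rw [hexp]
    rw [Finset.sum_comm]
    simp_rw [← Finset.sum_smul, ← Finset.mul_sum]
    rw [Finset.sum_range_succ, Finset.sum_range_succ, Finset.sum_range_succ,
      Finset.sum_eq_zero, h3, h4, hmid, hγ', mul_div_cancel₀ _ hch]
    · simp [show n + 4 - (n + 2) = 2 by omega, add_comm]
    · intro k hk
      rw [hlow k (Finset.mem_range.1 hk), mul_zero, zero_smul]
  rw [hsum]
  exact sum_mem fun i _ => smul_mem _ _ (subset_span ⟨i, rfl⟩)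

/-- case `t = 2` of Proposition 2.11 of the paper: for `d ≥ 4`, project the
rational normal curve of degree `d` from `O = a·x^d + b·x^{d−1}y` (with `b ≠ 0`), a point of
the tangent line at `[x^d]` other than `[x^d]`; the resulting curve `X ⊂ ℙⁿ`, `n = d − 1`, has
a cusp at `Q = [x^d mod O]`.  Every point of `E_Q(2) \ {Q}` — i.e. the class of any
`F ∈ span{x^d, x^{d−1}y, x^{d−2}y²} \ span{x^d, x^{d−1}y}` — has `X`-rank `n = d − 1`. -/
theorem rankX_osculating_two_of_cuspidal
    {K : Type*} [Field K] [IsAlgClosed K] [CharZero K] (d : ℕ) (hd : 4 ≤ d)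
    (a b : K) (hb : b ≠ 0)
    (O : MvPolynomial (Fin 2) K)
    (hO : O = a • ((X 0 : MvPolynomial (Fin 2) K) ^ d) +
      b • ((X 0 : MvPolynomial (Fin 2) K) ^ (d - 1) * X 1))
    (F : MvPolynomial (Fin 2) K)
    (hF : F ∈ span K ({(X 0 : MvPolynomial (Fin 2) K) ^ d,
      (X 0 : MvPolynomial (Fin 2) K) ^ (d - 1) * X 1,
      (X 0 : MvPolynomial (Fin 2) K) ^ (d - 2) * X 1 ^ 2} : Set (MvPolynomial (Fin 2) K)))
    (hF2 : F ∉ span K ({(X 0 : MvPolynomial (Fin 2) K) ^ d,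
      (X 0 : MvPolynomial (Fin 2) K) ^ (d - 1) * X 1} : Set (MvPolynomial (Fin 2) K))) :
    RX d O F = d - 1 := by
  obtain ⟨n, rfl⟩ : ∃ n, d = n + 4 := ⟨d - 4, by omega⟩
  obtain ⟨c₀, c₁, c₂, rfl⟩ := mem_span_triple.1 hF
  have hc : c₂ ≠ 0 := by
    rintro rfl
    exact hF2 (mem_span_pair.2 ⟨c₀, c₁, by rw [zero_smul, add_zero]⟩)
  subst hO
  refine IsLeast.csInf_eq ⟨?_, ?_⟩
  · obtain ⟨l, hl, hmem⟩ := exists_isLinForm_mem_span n (c₀ - c₁ / b * a) c₂ hc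
    refine ⟨l, hl, mem_span_insert.2 ⟨c₁ / b, _, hmem, ?_⟩⟩
    rw [smul_add, smul_smul, smul_smul, div_mul_cancel₀ _ hb, sub_smul]
    simp only [show n + 4 - 2 = n + 2 by omega]
    abel
  · rintro r ⟨l, hl, hmem⟩
    by_contra! hr
    exact notMem_span_of_card_add_two_le (by omega) a b c₀ c₁ c₂ hc l hl hmem
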